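/- Let 1 ≤ q < ∞. Then the volume radius of the Lorentz unit ball satisfies n^{1/q} · vol_n(B_{q,1}^n)^{1/n} → (2/q) e^{1/q} as n → ∞. -/

import Mathlib

open MeasureTheory Finset Filter
open scoped ENNReal NNReal

noncomputable section

/-- `sortedAbs x i` is the `i`-th largest value among `|x 0|, …, |x (n-1)|`
(`i = 0` gives the largest), i.e. the non-increasing rearrangement of `|x|`. -/
def sortedAbs {n : ℕ} (x : Fin n → ℝ) (i : Fin n) : ℝ :=
  |x (Tuple.sort (fun j => |x j|) i.rev)|

/-- The Lorentz norm `‖x‖_{q,1} = ∑_{i=1}^n i^{1/q-1} x_i^*` for `1 ≤ q < ∞`. -/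
def lorentzNorm (q : ℝ) {n : ℕ} (x : Fin n → ℝ) : ℝ :=
  ∑ i : Fin n, ((i : ℝ) + 1) ^ (1 / q - 1) * sortedAbs x i

/-- The unit ball of the Lorentz space `ℓ_{q,1}^n`. -/
def lorentzBall (q : ℝ) (n : ℕ) : Set (Fin n → ℝ) :=
  {x | lorentzNorm q x ≤ 1}

/-- The signed coordinate permutation `x ↦ (ε i * x (σ i))ᵢ`. -/
def signedPerm {n : ℕ} (g : Equiv.Perm (Fin n) × (Fin n → ℤˣ)) (x : Fin n → ℝ) : Fin n → ℝ :=
  fun i => ((g.2 i : ℤ) : ℝ) * x (g.1 i)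

/-- The open Weyl chamber of strictly decreasing positive vectors. -/
def weylChamber (n : ℕ) : Set (Fin n → ℝ) :=
  {x | (∀ i j, i < j → x j < x i) ∧ ∀ i, 0 < x i}

/-- The unit ball of the symmetric gauge `x ↦ ∑ i, w i * x_i^*`. -/
def rearrangementBall {n : ℕ} (w : Fin n → ℝ) : Set (Fin n → ℝ) :=
  {x | ∑ i, w i * sortedAbs x i ≤ 1}

lemma abs_signedPerm {n : ℕ} (g : Equiv.Perm (Fin n) × (Fin n → ℤˣ)) (x : Fin n → ℝ) (i : Fin n) :
    |signedPerm g x i| = |x (g.1 i)| := by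
  rcases Int.units_eq_one_or (g.2 i) with h | h <;> simp [signedPerm, h]

lemma sortedAbs_signedPerm {n : ℕ} (g : Equiv.Perm (Fin n) × (Fin n → ℤˣ)) (x : Fin n → ℝ) :
    sortedAbs (signedPerm g x) = sortedAbs x := by
  funext i
  have h : (fun j => |signedPerm g x j|) = (fun j => |x j|) ∘ g.1 := by
    funext j; exact abs_signedPerm g x j
  have := congrFun (Tuple.comp_perm_comp_sort_eq_comp_sort (f := fun j => |x j|) (σ := g.1)) i.rev
  rw [← h] at this
  simpa [sortedAbs, abs_signedPerm] using this

lemma sortedAbs_of_antitone {n : ℕ} {x : Fin n → ℝ} (hx : Antitone fun i => |x i|) (i : Fin n) :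
    sortedAbs x i = |x i| := by
  have h1 : Monotone ((fun j => |x j|) ∘ (Fin.revPerm : Equiv.Perm (Fin n))) :=
    fun a b hab => hx (by simpa using hab)
  have := congrFun (Tuple.comp_sort_eq_comp_iff_monotone.2 h1) i.rev
  simpa [sortedAbs] using this.symm

lemma sortedAbs_of_mem_weylChamber {n : ℕ} {x : Fin n → ℝ} (hx : x ∈ weylChamber n) :
    sortedAbs x = x := by
  have h : (fun i => |x i|) = x := funext fun i => abs_of_pos (hx.2 i)
  funext i
  rw [sortedAbs_of_antitone, abs_of_pos (hx.2 i)]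
  rw [h]
  exact (show StrictAnti x from fun i j hij => hx.1 i j hij).antitone

lemma measurePreserving_signedPerm {n : ℕ} (g : Equiv.Perm (Fin n) × (Fin n → ℤˣ)) :
    MeasurePreserving (signedPerm g) volume volume := by
  have h1 := volume_measurePreserving_piCongrLeft (fun _ : Fin n => ℝ) g.1.symm
  have h2 : MeasurePreserving (fun (x : Fin n → ℝ) i => ((g.2 i : ℤ) : ℝ) * x i) volume volume := by
    refine volume_preserving_pi (f := fun i t => ((g.2 i : ℤ) : ℝ) * t) fun i => ?_
    rcases Int.units_eq_one_or (g.2 i) with h | h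
    · simpa [h, Function.id_def] using MeasurePreserving.id (volume : Measure ℝ)
    · simpa [h] using Measure.measurePreserving_neg (volume : Measure ℝ)
  convert h2.comp h1 using 1
  funext x i
  simp only [signedPerm, Function.comp_apply]
  congr 1
  have := MeasurableEquiv.piCongrLeft_apply_apply (β := fun _ : Fin n => ℝ) g.1.symm x (g.1 i)
  simpa using this.symm

lemma measurableSet_weylChamber (n : ℕ) : MeasurableSet (weylChamber n) := by
  have : weylChamber n = (⋂ i, ⋂ j, ⋂ _ : i < j, {x | x j < x i}) ∩ ⋂ i, {x | 0 < x i} := by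
    ext x; simp [weylChamber]
  rw [this]
  refine MeasurableSet.inter (.iInter fun i => .iInter fun j => .iInter fun _ => ?_)
    (.iInter fun i => ?_)
  · exact measurableSet_lt (measurable_pi_apply j) (measurable_pi_apply i)
  · exact measurableSet_lt measurable_const (measurable_pi_apply i)

lemma eq_of_signedPerm_mem_weylChamber {n : ℕ} {g h : Equiv.Perm (Fin n) × (Fin n → ℤˣ)}
    {x : Fin n → ℝ} (hg : signedPerm g x ∈ weylChamber n) (hh : signedPerm h x ∈ weylChamber n) :
    g = h := by
  have key : signedPerm g x = signedPerm h x := by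
    rw [← sortedAbs_of_mem_weylChamber hg, ← sortedAbs_of_mem_weylChamber hh,
      sortedAbs_signedPerm, sortedAbs_signedPerm]
  have habs (i : Fin n) : |x (g.1 i)| = |x (h.1 i)| := by
    rw [← abs_signedPerm, ← abs_signedPerm, key]
  have hinj : Function.Injective fun i => |x (g.1 i)| := by
    intro i j hij
    simp only [← abs_signedPerm, abs_of_pos (hg.2 _)] at hij
    rcases lt_trichotomy i j with h1 | h1 | h1
    · exact absurd hij (hg.1 i j h1).ne'
    · exact h1
    · exact absurd hij (hg.1 j i h1).ne
  have h1 : g.1 = h.1 := by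
    ext1 i
    have : g.1.symm (h.1 i) = i := hinj (by simpa using (habs i).symm)
    exact (g.1.symm_apply_eq.1 this).symm
  refine Prod.ext h1 (funext fun i => ?_)
  have h2 := hg.2 i
  have h3 := hh.2 i
  simp only [signedPerm, ← h1] at h2 h3
  rcases Int.units_eq_one_or (g.2 i) with h4 | h4 <;>
    rcases Int.units_eq_one_or (h.2 i) with h5 | h5 <;> simp [h4, h5] at h2 h3 ⊢ <;> linarith

lemma exists_signedPerm_mem_weylChamber {n : ℕ} {x : Fin n → ℝ} (h0 : ∀ i, x i ≠ 0)
    (hx : ∀ i j, i ≠ j → |x i| ≠ |x j|) : ∃ g, signedPerm g x ∈ weylChamber n := by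
  classical
  set σ : Equiv.Perm (Fin n) := Fin.revPerm.trans (Tuple.sort fun j => |x j|) with hσ
  have hs (i : Fin n) : ∃ e : ℤˣ, ((e : ℤ) : ℝ) * x (σ i) = |x (σ i)| := by
    rcases le_total 0 (x (σ i)) with h | h
    · exact ⟨1, by simp [abs_of_nonneg h]⟩
    · exact ⟨-1, by simp [abs_of_nonpos h]⟩
  choose ε hε using hs
  refine ⟨(σ, ε), fun i j hij => ?_, fun i => ?_⟩
  · simp only [signedPerm, hε]
    refine lt_of_le_of_ne ?_ (hx _ _ fun h => hij.ne' (σ.injective h))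
    have := Tuple.monotone_sort (fun j => |x j|) (Fin.rev_le_rev.2 hij.le)
    simpa [hσ] using this
  · simp only [signedPerm, hε]
    exact abs_pos.2 (h0 _)

lemma volume_zeroSet_of_isLinearMap {n : ℕ} {f : (Fin n → ℝ) → ℝ} (hf : IsLinearMap ℝ f)
    {v : Fin n → ℝ} (hv : f v ≠ 0) : volume {x | f x = 0} = 0 := by
  have : {x | f x = 0} = (LinearMap.ker (hf.mk' f) : Set (Fin n → ℝ)) := by ext; simp
  rw [this]
  refine Measure.addHaar_submodule _ _ fun h => hv ?_
  have : v ∈ LinearMap.ker (hf.mk' f) := by rw [h]; trivial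
  simpa using this

lemma ae_exists_signedPerm_mem_weylChamber (n : ℕ) :
    ∀ᵐ x : Fin n → ℝ, ∃ g, signedPerm g x ∈ weylChamber n := by
  have h0 : ∀ᵐ x : Fin n → ℝ, ∀ i, x i ≠ 0 := by
    refine ae_all_iff.2 fun i => ?_
    have := volume_zeroSet_of_isLinearMap (f := fun x : Fin n → ℝ => x i)
      ⟨fun x y => rfl, fun c x => rfl⟩ (v := Pi.single i 1) (by simp)
    simpa [ae_iff] using this
  have h1 : ∀ᵐ x : Fin n → ℝ, ∀ i j, i ≠ j → x i - x j ≠ 0 := by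
    refine ae_all_iff.2 fun i => ae_all_iff.2 fun j => ?_
    by_cases hij : i = j
    · simp [hij]
    have := volume_zeroSet_of_isLinearMap (f := fun x : Fin n → ℝ => x i - x j)
      ⟨fun x y => by simp only [Pi.add_apply]; ring, fun c x => by simp [mul_sub]⟩
      (v := Pi.single i 1) (by simp [Ne.symm hij])
    simpa [ae_iff, hij] using this
  have h2 : ∀ᵐ x : Fin n → ℝ, ∀ i j, i ≠ j → x i + x j ≠ 0 := by
    refine ae_all_iff.2 fun i => ae_all_iff.2 fun j => ?_
    by_cases hij : i = j
    · simp [hij]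
    have := volume_zeroSet_of_isLinearMap (f := fun x : Fin n → ℝ => x i + x j)
      ⟨fun x y => by simp only [Pi.add_apply]; ring, fun c x => by simp [mul_add]⟩
      (v := Pi.single i 1) (by simp [Ne.symm hij])
    simpa [ae_iff, hij] using this
  filter_upwards [h0, h1, h2] with x hx0 hx1 hx2
  refine exists_signedPerm_mem_weylChamber hx0 fun i j hij h => ?_
  rcases abs_eq_abs.1 h with h | h
  · exact hx1 i j hij (by linarith)
  · exact hx2 i j hij (by linarith)

lemma rearrangementBall_inter_weylChamber {n : ℕ} (w : Fin n → ℝ) :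
    rearrangementBall w ∩ weylChamber n = {x | ∑ i, w i * x i ≤ 1} ∩ weylChamber n := by
  ext x
  refine and_congr_left fun hx => ?_
  simp [rearrangementBall, sortedAbs_of_mem_weylChamber hx]

lemma volume_rearrangementBall {n : ℕ} (w : Fin n → ℝ) :
    volume (rearrangementBall w) = Fintype.card (Equiv.Perm (Fin n) × (Fin n → ℤˣ)) *
      volume ({x | ∑ i, w i * x i ≤ 1} ∩ weylChamber n) := by
  set A := {x | ∑ i, w i * x i ≤ 1} ∩ weylChamber n
  have hA : MeasurableSet A := by
    refine MeasurableSet.inter (measurableSet_le ?_ measurable_const) (measurableSet_weylChamber n)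
    fun_prop
  have hae : rearrangementBall w =ᵐ[volume] ⋃ g, signedPerm g ⁻¹' A := by
    filter_upwards [ae_exists_signedPerm_mem_weylChamber n] with x hx
    refine propext ?_
    change x ∈ rearrangementBall w ↔ x ∈ ⋃ g, signedPerm g ⁻¹' A
    simp only [A, ← rearrangementBall_inter_weylChamber, Set.mem_iUnion, Set.mem_preimage,
      Set.mem_inter_iff]
    have hinv (g) : signedPerm g x ∈ rearrangementBall w ↔ x ∈ rearrangementBall w := by
      simp [rearrangementBall, sortedAbs_signedPerm]
    simp only [hinv, exists_and_left, hx, and_true]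
  rw [measure_congr hae, measure_iUnion]
  · simp_rw [(measurePreserving_signedPerm _).measure_preimage hA.nullMeasurableSet]
    rw [tsum_fintype, Finset.sum_const, nsmul_eq_mul, Finset.card_univ]
  · intro g h hgh
    refine Set.disjoint_left.2 fun x hx hx' => hgh ?_
    exact eq_of_signedPerm_mem_weylChamber hx.2 hx'.2
  · exact fun g => (measurePreserving_signedPerm g).measurable hA

/-- The upper triangular matrix of ones, sending a vector to its tail sums. -/
def tailSumMatrix (n : ℕ) : Matrix (Fin n) (Fin n) ℝ :=
  Matrix.of fun i j => if i ≤ j then 1 else 0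

lemma det_tailSumMatrix (n : ℕ) : (tailSumMatrix n).det = 1 := by
  rw [Matrix.det_of_isUpperTriangular]
  · simp [tailSumMatrix]
  · intro i j hij
    have : j < i := hij
    simp [tailSumMatrix, this.not_ge]

lemma tailSumMatrix_toLin'_apply {n : ℕ} (y : Fin n → ℝ) (i : Fin n) :
    (tailSumMatrix n).toLin' y i = ∑ j ∈ Finset.Ici i, y j := by
  simp [Matrix.toLin'_apply, Matrix.mulVec, dotProduct, tailSumMatrix, ← Finset.sum_filter]
  congr 1
  ext; simp

lemma tailSumMatrix_toLin'_mem_weylChamber {n : ℕ} (y : Fin n → ℝ) :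
    (tailSumMatrix n).toLin' y ∈ weylChamber n ↔ ∀ i, 0 < y i := by
  constructor
  · intro h i
    by_cases hi : (i : ℕ) + 1 < n
    · have h1 := h.1 i ⟨i + 1, hi⟩ (by simp [Fin.lt_def])
      have h2 : Finset.Ici i = insert i (Finset.Ici ⟨i + 1, hi⟩) := by
        ext j
        simp only [Finset.mem_Ici, Finset.mem_insert, Fin.le_def, Fin.ext_iff]
        omega
      rw [tailSumMatrix_toLin'_apply, tailSumMatrix_toLin'_apply, h2,
        Finset.sum_insert (by simp [Fin.le_def])] at h1
      linarith
    · have h1 := h.2 i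
      have h2 : Finset.Ici i = {i} := by
        ext j
        simp only [Finset.mem_Ici, Finset.mem_singleton, Fin.le_def, Fin.ext_iff]
        omega
      rwa [tailSumMatrix_toLin'_apply, h2, Finset.sum_singleton] at h1
  · intro h
    refine ⟨fun i j hij => ?_, fun i => ?_⟩
    · rw [tailSumMatrix_toLin'_apply, tailSumMatrix_toLin'_apply]
      refine Finset.sum_lt_sum_of_subset (i := i) (Finset.Ici_subset_Ici.2 hij.le) (by simp)
        (by simpa using hij) (h i) fun k _ _ => (h k).le
    · rw [tailSumMatrix_toLin'_apply]
      exact Finset.sum_pos (fun k _ => h k) ⟨i, by simp⟩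

lemma volume_weylChamber_section_eq_simplex {n : ℕ} (w : Fin n → ℝ) :
    volume ({x | ∑ i, w i * x i ≤ 1} ∩ weylChamber n) =
      volume {y : Fin n → ℝ | ∑ j, (∑ i ∈ Finset.Iic j, w i) * y j ≤ 1 ∧ ∀ j, 0 < y j} := by
  have hd : LinearMap.det (tailSumMatrix n).toLin' = 1 := by
    rw [LinearMap.det_toLin', det_tailSumMatrix]
  have := Measure.addHaar_preimage_linearMap (volume : Measure (Fin n → ℝ))
    (f := (tailSumMatrix n).toLin') (by rw [hd]; exact one_ne_zero)
    ({x | ∑ i, w i * x i ≤ 1} ∩ weylChamber n)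
  rw [hd, inv_one, abs_one, ENNReal.ofReal_one, one_mul] at this
  rw [← this]
  congr 1
  ext y
  refine and_congr ?_ (tailSumMatrix_toLin'_mem_weylChamber y)
  simp only [Set.mem_ofPred_eq, tailSumMatrix_toLin'_apply]
  have : ∑ i, w i * ∑ j ∈ Finset.Ici i, y j = ∑ j, (∑ i ∈ Finset.Iic j, w i) * y j := by
    simp only [Finset.mul_sum, Finset.sum_mul]
    exact Finset.sum_comm' (by simp)
  rw [this]

lemma volume_simplex {n : ℕ} {W : Fin n → ℝ} (hW : ∀ i, 0 < W i) :
    volume {y : Fin n → ℝ | ∑ j, W j * y j ≤ 1 ∧ ∀ j, 0 < y j} =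
      ENNReal.ofReal (∏ i, W i)⁻¹ * volume {y : Fin n → ℝ | ∑ j, y j ≤ 1 ∧ ∀ j, 0 < y j} := by
  have hp : 0 < ∏ i, W i := Finset.prod_pos fun i _ => hW i
  have hd : LinearMap.det (Matrix.diagonal W).toLin' = ∏ i, W i := by
    rw [LinearMap.det_toLin', Matrix.det_diagonal]
  have := Measure.addHaar_preimage_linearMap (volume : Measure (Fin n → ℝ))
    (f := (Matrix.diagonal W).toLin') (by rw [hd]; exact hp.ne')
    {y : Fin n → ℝ | ∑ j, y j ≤ 1 ∧ ∀ j, 0 < y j}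
  rw [hd, abs_of_pos (inv_pos.2 hp)] at this
  rw [← this]
  congr 1
  ext y
  simp [Matrix.toLin'_apply, Matrix.mulVec_diagonal, hW]

lemma volume_rearrangementBall_one (n : ℕ) :
    volume (rearrangementBall (fun _ : Fin n => (1 : ℝ))) = ENNReal.ofReal (2 ^ n / n.factorial) := by
  have hset : rearrangementBall (fun _ : Fin n => (1 : ℝ)) = {x | ∑ i, |x i| ≤ 1} := by
    ext x
    have : ∑ i, sortedAbs x i = ∑ i, |x i| :=
      Equiv.sum_comp (Fin.revPerm.trans (Tuple.sort fun j => |x j|)) (fun i => |x i|)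
    simp [rearrangementBall, this]
  rw [hset]
  rcases n.eq_zero_or_pos with rfl | hn
  · simp [volume_pi]
  · have : Nonempty (Fin n) := ⟨⟨0, hn⟩⟩
    have := volume_sum_rpow_le (ι := Fin n) le_rfl 1
    have hG : Real.Gamma (1 + 1) = 1 := by simpa using Real.Gamma_nat_eq_factorial 1
    simpa [Real.Gamma_nat_eq_factorial, hG] using this

lemma volume_rearrangementBall_eq {n : ℕ} {w : Fin n → ℝ} (hw : ∀ i, 0 < w i) :
    volume (rearrangementBall w) =
      ENNReal.ofReal (2 ^ n / ∏ j, ∑ i ∈ Finset.Iic j, w i) := by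
  have key {v : Fin n → ℝ} (hv : ∀ i, 0 < v i) : volume (rearrangementBall v) =
      ENNReal.ofReal (∏ j, ∑ i ∈ Finset.Iic j, v i)⁻¹ *
        (Fintype.card (Equiv.Perm (Fin n) × (Fin n → ℤˣ)) *
          volume {y : Fin n → ℝ | ∑ j, y j ≤ 1 ∧ ∀ j, 0 < y j}) := by
    rw [volume_rearrangementBall, volume_weylChamber_section_eq_simplex,
      volume_simplex fun j => Finset.sum_pos (fun i _ => hv i) ⟨j, by simp⟩, mul_left_comm]
  have h1 := key (v := fun _ => 1) fun _ => one_pos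
  have hf : ∏ j : Fin n, ∑ i ∈ Finset.Iic j, (1 : ℝ) = n.factorial := by
    simp only [Finset.sum_const, Fin.card_Iic, nsmul_eq_mul, mul_one]
    rw [Fin.prod_univ_eq_prod_range (fun i : ℕ => ((i + 1 : ℕ) : ℝ)) n,
      ← Finset.prod_range_add_one_eq_factorial]
    push_cast; rfl
  rw [volume_rearrangementBall_one, hf] at h1
  have hn : (0 : ℝ) < n.factorial := by positivity
  have h2 : (Fintype.card (Equiv.Perm (Fin n) × (Fin n → ℤˣ)) : ℝ≥0∞) *
      volume {y : Fin n → ℝ | ∑ j, y j ≤ 1 ∧ ∀ j, 0 < y j} = ENNReal.ofReal (2 ^ n) := by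
    have h3 := congrArg (ENNReal.ofReal n.factorial * ·) h1
    beta_reduce at h3
    rw [← mul_assoc, ← ENNReal.ofReal_mul hn.le, ← ENNReal.ofReal_mul hn.le,
      mul_inv_cancel₀ hn.ne', ENNReal.ofReal_one, one_mul, mul_div_cancel₀ _ hn.ne'] at h3
    exact h3.symm
  rw [key hw, h2, ← ENNReal.ofReal_mul, inv_mul_eq_div]
  exact inv_nonneg.2 (Finset.prod_nonneg fun j _ => Finset.sum_nonneg fun i _ => (hw i).le)

lemma toReal_volume_lorentzBall (q : ℝ) (n : ℕ) :
    (volume (lorentzBall q n)).toReal =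
      2 ^ n / ∏ k ∈ Finset.range n, ∑ i ∈ Finset.range (k + 1), ((i : ℝ) + 1) ^ (1 / q - 1) := by
  have hpos (i : ℕ) : 0 < ((i : ℝ) + 1) ^ (1 / q - 1) := by positivity
  have h := volume_rearrangementBall_eq (w := fun i : Fin n => ((i : ℝ) + 1) ^ (1 / q - 1))
    fun i => hpos i
  have hp : ∏ j : Fin n, ∑ i ∈ Finset.Iic j, ((i : ℝ) + 1) ^ (1 / q - 1) =
      ∏ k ∈ Finset.range n, ∑ i ∈ Finset.range (k + 1), ((i : ℝ) + 1) ^ (1 / q - 1) := by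
    rw [← Fin.prod_univ_eq_prod_range]
    refine Finset.prod_congr rfl fun j _ => ?_
    rw [Nat.range_succ_eq_Iic, ← Fin.map_valEmbedding_Iic, Finset.sum_map]
    rfl
  have : lorentzBall q n = rearrangementBall fun i : Fin n => ((i : ℝ) + 1) ^ (1 / q - 1) := rfl
  rw [this, h, hp, ENNReal.toReal_ofReal]
  exact div_nonneg (by positivity)
    (Finset.prod_nonneg fun k _ => Finset.sum_nonneg fun i _ => (hpos i).le)

lemma add_rpow_le_tangent {a t s : ℝ} (ha0 : 0 ≤ a) (ha1 : a ≤ 1) (ht : 0 < t) (hs : 0 ≤ t + s) :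
    (t + s) ^ a ≤ t ^ a + a * s * t ^ (a - 1) := by
  have h1 : -1 ≤ s / t := by rw [le_div_iff₀ ht]; linarith
  have h := rpow_one_add_le_one_add_mul_self h1 ha0 ha1
  have h2 : t + s = t * (1 + s / t) := by field_simp
  rw [h2, Real.mul_rpow ht.le (by linarith), Real.rpow_sub_one ht.ne']
  calc t ^ a * (1 + s / t) ^ a ≤ t ^ a * (1 + a * (s / t)) := by gcongr
    _ = _ := by field_simp

lemma mul_sum_rpow_le {a : ℝ} (ha0 : 0 < a) (ha1 : a ≤ 1) (n : ℕ) :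
    a * ∑ i ∈ Finset.range n, ((i : ℝ) + 1) ^ (a - 1) ≤ (n : ℝ) ^ a := by
  induction n with
  | zero => simp [Real.zero_rpow ha0.ne']
  | succ n ih =>
    have h := add_rpow_le_tangent (t := n + 1) (s := -1) ha0.le ha1 (by positivity) (by simp)
    rw [Finset.sum_range_succ, mul_add]
    push_cast
    have h2 : (n : ℝ) + 1 + -1 = n := by ring
    rw [h2] at h
    linarith

lemma le_mul_sum_rpow {a : ℝ} (ha0 : 0 < a) (ha1 : a ≤ 1) (n : ℕ) :
    ((n : ℝ) + 1) ^ a - 1 ≤ a * ∑ i ∈ Finset.range n, ((i : ℝ) + 1) ^ (a - 1) := by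
  induction n with
  | zero => simp
  | succ n ih =>
    have h := add_rpow_le_tangent (t := n + 1) (s := 1) ha0.le ha1 (by positivity) (by positivity)
    rw [Finset.sum_range_succ, mul_add]
    push_cast
    linarith

lemma tendsto_sum_rpow_div_rpow {a : ℝ} (ha0 : 0 < a) (ha1 : a ≤ 1) :
    Tendsto (fun n : ℕ => (∑ i ∈ Finset.range n, ((i : ℝ) + 1) ^ (a - 1)) / (n : ℝ) ^ a)
      atTop (nhds a⁻¹) := by
  have h0 : Tendsto (fun n : ℕ => ((n : ℝ) ^ a)⁻¹) atTop (nhds 0) :=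
    ((tendsto_rpow_atTop ha0).comp tendsto_natCast_atTop_atTop).inv_tendsto_atTop
  have hlow : Tendsto (fun n : ℕ => a⁻¹ * (1 - ((n : ℝ) ^ a)⁻¹)) atTop (nhds a⁻¹) := by
    simpa using (h0.const_sub 1).const_mul a⁻¹
  refine tendsto_of_tendsto_of_tendsto_of_le_of_le' hlow tendsto_const_nhds ?_ ?_
  · filter_upwards [eventually_gt_atTop 0] with n hn
    have hn : (0 : ℝ) < (n : ℝ) ^ a := Real.rpow_pos_of_pos (by exact_mod_cast hn) _
    have h1 : (n : ℝ) ^ a ≤ ((n : ℝ) + 1) ^ a := by gcongr; linarith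
    have h2 := le_mul_sum_rpow ha0 ha1 n
    rw [le_div_iff₀ hn, mul_assoc, inv_mul_le_iff₀ ha0, sub_mul, inv_mul_cancel₀ hn.ne']
    linarith
  · filter_upwards [eventually_gt_atTop 0] with n hn
    have hn : (0 : ℝ) < (n : ℝ) ^ a := Real.rpow_pos_of_pos (by exact_mod_cast hn) _
    rw [div_le_iff₀ hn, le_inv_mul_iff₀ ha0]
    exact mul_sum_rpow_le ha0 ha1 n

lemma tendsto_log_sub_log_factorial_div :
    Tendsto (fun n : ℕ => Real.log n - (n : ℝ)⁻¹ * Real.log n.factorial) atTop (nhds 1) := by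
  have h1 : Tendsto (fun n : ℕ => Real.log (Stirling.stirlingSeq n)) atTop
      (nhds (Real.log √Real.pi)) :=
    Stirling.tendsto_stirlingSeq_sqrt_pi.log (by positivity)
  have hinv : Tendsto (fun n : ℕ => (n : ℝ)⁻¹) atTop (nhds 0) :=
    tendsto_inv_atTop_nhds_zero_nat
  have h2 : Tendsto (fun n : ℕ => Real.log (2 * n) / (2 * n)) atTop (nhds 0) := by
    have := Real.isLittleO_log_id_atTop.tendsto_div_nhds_zero
    exact this.comp (tendsto_natCast_atTop_atTop.const_mul_atTop (by norm_num : (0 : ℝ) < 2))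
  have h := ((hinv.mul h1).add h2).const_sub 1
  simp only [zero_mul, add_zero, sub_zero] at h
  refine h.congr' ?_
  filter_upwards [eventually_gt_atTop 0] with n hn
  have hn' : (0 : ℝ) < n := by exact_mod_cast hn
  rw [Stirling.log_stirlingSeq_formula, Real.log_div hn'.ne' (Real.exp_pos 1).ne', Real.log_exp]
  field_simp
  ring

/-- For `1 ≤ q < ∞`, the volume radius satisfies
`n^{1/q} vol_n(B_{q,1}^n)^{1/n} → (2/q) e^{1/q}` as `n → ∞`. -/
theorem volume_radius_lorentzBall (q : ℝ) (hq : 1 ≤ q) :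
    Tendsto (fun n : ℕ =>
        (n : ℝ) ^ (1 / q) * (volume (lorentzBall q n)).toReal ^ ((n : ℝ)⁻¹))
      atTop (nhds (2 / q * Real.exp (1 / q))) := by
  have hq0 : 0 < q := by linarith
  set a : ℝ := 1 / q with ha
  have ha0 : 0 < a := by positivity
  have ha1 : a ≤ 1 := (div_le_one hq0).2 hq
  set W : ℕ → ℝ := fun k => ∑ i ∈ Finset.range (k + 1), ((i : ℝ) + 1) ^ (a - 1) with hW
  have hWpos (k : ℕ) : 0 < W k :=
    Finset.sum_pos (fun i _ => by positivity) ⟨0, by simp⟩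
  have hlog : Tendsto (fun k : ℕ => Real.log (W k / ((k + 1 : ℕ) : ℝ) ^ a)) atTop
      (nhds (Real.log a⁻¹)) :=
    ((tendsto_sum_rpow_div_rpow ha0 ha1).comp (tendsto_add_atTop_nat 1)).log
      (inv_pos.2 ha0).ne'
  have hlim := ((tendsto_log_sub_log_factorial_div.const_mul a).sub hlog.cesaro).const_add
    (Real.log 2)
  have hexp := hlim.rexp
  have hval : Real.exp (Real.log 2 + (a * 1 - Real.log a⁻¹)) = 2 / q * Real.exp a := by
    rw [Real.log_inv, mul_one, sub_neg_eq_add, add_comm a, ← add_assoc, Real.exp_add, Real.exp_add,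
      Real.exp_log two_pos, Real.exp_log ha0, ha]
    ring
  rw [hval] at hexp
  refine hexp.congr' ?_
  filter_upwards [eventually_gt_atTop 0] with n hn
  have hn' : (0 : ℝ) < n := by exact_mod_cast hn
  have hP : 0 < ∏ k ∈ Finset.range n, W k := Finset.prod_pos fun k _ => hWpos k
  have hsum : ∑ k ∈ Finset.range n, Real.log (W k / ((k + 1 : ℕ) : ℝ) ^ a) =
      Real.log (∏ k ∈ Finset.range n, W k) - a * Real.log n.factorial := by
    rw [← Finset.prod_range_add_one_eq_factorial, Nat.cast_prod,
      Real.log_prod fun k _ => (hWpos k).ne',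
      Real.log_prod fun k _ => by positivity, Finset.mul_sum, ← Finset.sum_sub_distrib]
    refine Finset.sum_congr rfl fun k _ => ?_
    rw [Real.log_div (hWpos k).ne' (by positivity), Real.log_rpow (by positivity)]
  rw [toReal_volume_lorentzBall, hsum, Real.rpow_def_of_pos hn',
    Real.rpow_def_of_pos (div_pos (by positivity) hP), ← Real.exp_add,
    Real.log_div (by positivity) hP.ne', Real.log_pow]
  congr 1
  field_simp
  ring

end
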